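/- For every prime q, the natural density d(q) of M(q) exists and equals 1 - (Σ_{m ∈ M^c(q)} q^{-m})^{-1} · ∏_{p prime} [(1 - 1/p) · Σ_{m ∈ M^c(q)} 1/p^m], where the product is over all primes p (including q). -/

import Mathlib

open Filter Topology

/-- `TowerMem q n` means that the prime `q` occurs somewhere in the tower
factorization of the positive integer `n`:  `1 ∉ M(q)`, and for `n ≥ 2`,
`n ∈ M(q)` iff `q ∣ n` or some exponent in the prime factorization of `n`
lies in `M(q)`. -/
inductive TowerMem (q : ℕ) : ℕ → Prop
  | base (n : ℕ) (hn : 2 ≤ n) (hdvd : q ∣ n) : TowerMem q n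
  | step (n p : ℕ) (hn : 2 ≤ n) (hp : p.Prime) (hdvd : p ∣ n)
      (hexp : TowerMem q (n.factorization p)) : TowerMem q n

open Classical in
/-- The proportion of the integers `{1, …, N}` that lie in `M(q)`. -/
noncomputable def towerRatio (q N : ℕ) : ℝ :=
  (((Finset.Icc 1 N).filter fun n => TowerMem q n).card : ℝ) / (N : ℝ)

/-- The number of elements of `A` in `{1, …, N}`. -/
noncomputable def countUpTo (A : Set ℕ) (N : ℕ) : ℕ :=
  Set.ncard {n | 1 ≤ n ∧ n ≤ N ∧ n ∈ A}

/-- `A` has natural density `δ`. -/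
def HasNatDensity (A : Set ℕ) (δ : ℝ) : Prop :=
  Tendsto (fun N => (countUpTo A N : ℝ) / N) atTop (𝓝 δ)

theorem finite_bounded_part (A : Set ℕ) (N : ℕ) : {n | 1 ≤ n ∧ n ≤ N ∧ n ∈ A}.Finite :=
  (Set.finite_Icc 1 N).subset fun _ h => ⟨h.1, h.2.1⟩

theorem countUpTo_mono {A B : Set ℕ} (h : A ⊆ B) (N : ℕ) : countUpTo A N ≤ countUpTo B N :=
  Set.ncard_le_ncard (fun _ hn => ⟨hn.1, hn.2.1, h hn.2.2⟩) (finite_bounded_part B N)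

theorem countUpTo_univ (N : ℕ) : countUpTo Set.univ N = N := by
  have : {n : ℕ | 1 ≤ n ∧ n ≤ N ∧ n ∈ Set.univ} = ((Finset.Icc 1 N : Finset ℕ) : Set ℕ) := by
    ext n; simp
  rw [countUpTo, this, Set.ncard_coe_finset, Nat.card_Icc, Nat.add_sub_cancel]

theorem countUpTo_le (A : Set ℕ) (N : ℕ) : countUpTo A N ≤ N :=
  (countUpTo_mono (Set.subset_univ A) N).trans_eq (countUpTo_univ N)

theorem countUpTo_union_of_disjoint {A B : Set ℕ} (h : ∀ n, 1 ≤ n → n ∈ A → n ∉ B) (N : ℕ) :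
    countUpTo (A ∪ B) N = countUpTo A N + countUpTo B N := by
  rw [countUpTo, countUpTo, countUpTo,
    ← Set.ncard_union_eq _ (finite_bounded_part A N) (finite_bounded_part B N)]
  · congr 1; ext n; simp only [Set.mem_ofPred_eq, Set.mem_union]; tauto
  · exact Set.disjoint_left.2 fun n ha hb => h n ha.1 ha.2.2 hb.2.2

theorem countUpTo_union_le (A B : Set ℕ) (N : ℕ) :
    countUpTo (A ∪ B) N ≤ countUpTo A N + countUpTo B N := by
  refine le_trans (Set.ncard_le_ncard ?_ ?_) (Set.ncard_union_le _ _)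
  · rintro n ⟨h1, h2, h3 | h3⟩
    · exact Or.inl ⟨h1, h2, h3⟩
    · exact Or.inr ⟨h1, h2, h3⟩
  · exact (finite_bounded_part A N).union (finite_bounded_part B N)

theorem countUpTo_multiples {A : Set ℕ} {d : ℕ} (hd : 0 < d)
    (hA : ∀ n, 1 ≤ n → (d * n ∈ A ↔ n ∈ A)) (N : ℕ) :
    countUpTo {n | n ∈ A ∧ d ∣ n} N = countUpTo A (N / d) := by
  rw [countUpTo, countUpTo,
    ← Set.ncard_image_of_injective {n | 1 ≤ n ∧ n ≤ N / d ∧ n ∈ A} (mul_right_injective₀ hd.ne')]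
  congr 1
  ext n
  constructor
  · rintro ⟨h1, h2, h3, k, rfl⟩
    have hk : 1 ≤ k := Nat.pos_of_mul_pos_left h1
    exact ⟨k, ⟨hk, (Nat.le_div_iff_mul_le hd).2 (by rwa [mul_comm]), (hA k hk).1 h3⟩, rfl⟩
  · rintro ⟨k, ⟨h1, h2, h3⟩, rfl⟩
    have := (Nat.le_div_iff_mul_le hd).1 h2
    exact ⟨Nat.mul_pos hd h1, by simpa [mul_comm] using this, (hA k h1).2 h3, dvd_mul_right _ _⟩

theorem mem_pow_mul_iff {A : Set ℕ} {p : ℕ} (hp : 0 < p)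
    (hA : ∀ n, 1 ≤ n → (p * n ∈ A ↔ n ∈ A)) (m n : ℕ) (hn : 1 ≤ n) :
    p ^ m * n ∈ A ↔ n ∈ A := by
  induction m with
  | zero => simp
  | succ m ih =>
    rw [pow_succ', mul_assoc, hA _ (Nat.mul_pos (pow_pos hp m) hn), ih]

theorem countUpTo_factorization_eq {A : Set ℕ} {p : ℕ} (hp : p.Prime)
    (hA : ∀ n, 1 ≤ n → (p * n ∈ A ↔ n ∈ A)) (m N : ℕ) :
    countUpTo {n | n ∈ A ∧ n.factorization p = m} N + countUpTo A (N / p ^ (m + 1)) =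
      countUpTo A (N / p ^ m) := by
  rw [← countUpTo_multiples (pow_pos hp.pos m) (mem_pow_mul_iff hp.pos hA m),
    ← countUpTo_multiples (pow_pos hp.pos (m + 1)) (mem_pow_mul_iff hp.pos hA (m + 1)),
    ← countUpTo_union_of_disjoint]
  · rw [countUpTo, countUpTo]
    congr 1
    ext n
    simp only [Set.mem_ofPred_eq, Set.mem_union, and_congr_right_iff]
    intro h1 _
    rw [hp.pow_dvd_iff_le_factorization (by omega), hp.pow_dvd_iff_le_factorization (by omega),
      ← and_or_left]
    exact and_congr_right fun _ => by omega
  · rintro n hn ⟨-, h⟩ ⟨-, h'⟩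
    rw [hp.pow_dvd_iff_le_factorization (by omega)] at h'
    omega

theorem tendsto_countUpTo_div {A : Set ℕ} {δ : ℝ} (hA : HasNatDensity A δ) {d : ℕ} (hd : 0 < d) :
    Tendsto (fun N => (countUpTo A (N / d) : ℝ) / N) atTop (𝓝 (δ / d)) := by
  have h1 : Tendsto (fun N : ℕ => N / d) atTop atTop := Nat.tendsto_div_const_atTop hd.ne'
  have h2 : Tendsto (fun N : ℕ => ((N / d : ℕ) : ℝ) / N) atTop (𝓝 (1 / d)) := by
    have := (tendsto_nat_floor_mul_div_atTop (R := ℝ) (a := 1 / d) (by positivity)).comp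
      (tendsto_natCast_atTop_atTop (R := ℝ))
    refine this.congr fun N => ?_
    simp only [Function.comp]
    rw [one_div_mul_eq_div, Nat.floor_div_eq_div]
  have h3 := (hA.comp h1).mul h2
  rw [mul_one_div] at h3
  refine h3.congr fun N => ?_
  simp only [Function.comp]
  rcases Nat.eq_zero_or_pos (N / d) with h | h
  · simp [h, Nat.le_zero.1 (countUpTo_le A 0)]
  · have : ((N / d : ℕ) : ℝ) ≠ 0 := by exact_mod_cast h.ne'
    field_simp

theorem hasSum_countUpTo_factorization_mem (A E : Set ℕ) (p N : ℕ) :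
    HasSum (fun m : E => (countUpTo {n | n ∈ A ∧ n.factorization p = m} N : ℝ))
      (countUpTo {n | n ∈ A ∧ n.factorization p ∈ E} N) := by
  classical
  have hfin := finite_bounded_part {n | n ∈ A ∧ n.factorization p ∈ E} N
  have h : HasSum (fun m : E => ∑ n ∈ hfin.toFinset,
      if n.factorization p = (m : ℕ) then (1 : ℝ) else 0) (∑ n ∈ hfin.toFinset, 1) := by
    refine hasSum_sum fun n hn => ?_
    have hE : n.factorization p ∈ E := ((Set.Finite.mem_toFinset _).1 hn).2.2.2
    refine (hasSum_ite_eq (⟨n.factorization p, hE⟩ : E) (1 : ℝ)).congr_fun fun m => ?_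
    simp only [Subtype.ext_iff, eq_comm]
  convert h using 2 with m
  · rw [Finset.sum_boole, countUpTo, ← Set.ncard_coe_finset]
    congr 2
    ext n
    simp only [Set.mem_ofPred_eq, Finset.coe_filter, Set.Finite.mem_toFinset]
    constructor
    · rintro ⟨h1, h2, h3, h4⟩
      exact ⟨⟨h1, h2, h3, h4 ▸ m.2⟩, h4⟩
    · rintro ⟨⟨h1, h2, h3, -⟩, h4⟩
      exact ⟨h1, h2, h3, h4⟩
  · rw [Finset.sum_const, nsmul_one, countUpTo, Set.ncard_eq_toFinset_card _ hfin]

theorem HasNatDensity.factorization_mem {A : Set ℕ} {δ : ℝ} (hδ : HasNatDensity A δ)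
    {p : ℕ} (hp : p.Prime) (hA : ∀ n, 1 ≤ n → (p * n ∈ A ↔ n ∈ A)) (E : Set ℕ) :
    HasNatDensity {n | n ∈ A ∧ n.factorization p ∈ E}
      (δ * ((1 - 1 / (p : ℝ)) * ∑' m : E, 1 / (p : ℝ) ^ (m : ℕ))) := by
  have hp0 : (0 : ℝ) < p := by exact_mod_cast hp.pos
  have hp1 : (1 : ℝ) < p := by exact_mod_cast hp.one_lt
  have hsum : Summable fun m : ℕ => 1 / (p : ℝ) ^ m := by
    simpa [one_div] using summable_geometric_of_lt_one (inv_nonneg.2 hp0.le) (inv_lt_one_of_one_lt₀ hp1)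
  have key : Tendsto (fun N : ℕ => ∑' m : E,
      (countUpTo {n | n ∈ A ∧ n.factorization p = m} N : ℝ) / N) atTop
      (𝓝 (∑' m : E, δ * ((1 - 1 / (p : ℝ)) * (1 / (p : ℝ) ^ (m : ℕ))))) := by
    refine tendsto_tsum_of_dominated_convergence (bound := fun m : E => 1 / (p : ℝ) ^ (m : ℕ))
      (hsum.subtype E) ?_ ?_
    · intro m
      have h := (tendsto_countUpTo_div hδ (pow_pos hp.pos (m : ℕ))).sub
        (tendsto_countUpTo_div hδ (pow_pos hp.pos ((m : ℕ) + 1)))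
      have e : δ * ((1 - 1 / (p : ℝ)) * (1 / (p : ℝ) ^ (m : ℕ))) =
          δ / ((p ^ (m : ℕ) : ℕ) : ℝ) - δ / ((p ^ ((m : ℕ) + 1) : ℕ) : ℝ) := by
        push_cast; field_simp; ring
      rw [e]
      refine h.congr fun N => ?_
      rw [← countUpTo_factorization_eq hp hA m N]
      push_cast
      ring
    · refine Eventually.of_forall fun N m => ?_
      rw [Real.norm_of_nonneg (by positivity)]
      rcases Nat.eq_zero_or_pos N with rfl | hN
      · simp
      have hN' : (0 : ℝ) < N := by exact_mod_cast hN
      rw [div_le_iff₀ hN', one_div_mul_eq_div]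
      have h1 : countUpTo {n | n ∈ A ∧ n.factorization p = m} N ≤ N / p ^ (m : ℕ) :=
        (Nat.le_add_right _ _).trans
          ((countUpTo_factorization_eq hp hA m N).trans_le (countUpTo_le _ _))
      calc (countUpTo {n | n ∈ A ∧ n.factorization p = m} N : ℝ) ≤ ((N / p ^ (m : ℕ) : ℕ) : ℝ) := by
            exact_mod_cast h1
        _ ≤ _ := by simpa using Nat.cast_div_le (α := ℝ) (m := N) (n := p ^ (m : ℕ))
  rw [tsum_mul_left, tsum_mul_left] at key
  refine key.congr fun N => ?_
  rw [tsum_div_const, (hasSum_countUpTo_factorization_mem A E p N).tsum_eq]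

theorem hasNatDensity_univ : HasNatDensity Set.univ 1 := by
  refine tendsto_const_nhds.congr' ?_
  filter_upwards [eventually_gt_atTop 0] with N hN
  rw [countUpTo_univ, div_self (by exact_mod_cast hN.ne')]

theorem hasNatDensity_forall_factorization_mem (F : ℕ → Set ℕ) (P : Finset {p : ℕ // p.Prime}) :
    HasNatDensity {n | ∀ p ∈ P, n.factorization p ∈ F p}
      (∏ p ∈ P, ((1 - 1 / ((p : ℕ) : ℝ)) * ∑' m : F p, 1 / ((p : ℕ) : ℝ) ^ (m : ℕ))) := by
  classical
  induction P using Finset.induction_on with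
  | empty => simpa using hasNatDensity_univ
  | insert p P hpP ih =>
    rw [Finset.prod_insert hpP, mul_comm]
    have := ih.factorization_mem p.2 (fun n hn => ?_) (F p)
    · convert this using 2
      ext n
      simp [and_comm]
    · simp only [Set.mem_ofPred_eq]
      refine forall₂_congr fun r hr => ?_
      have hne : (p : ℕ) ≠ r := fun h => hpP (Subtype.ext h ▸ hr)
      rw [Nat.factorization_mul p.2.ne_zero (by omega), Finsupp.add_apply,
        p.2.factorization, Finsupp.single_eq_of_ne (by tauto), zero_add]

theorem tendsto_of_uniform_approx {ι : Type*} {l : Filter ι} [l.NeBot] {f : ℕ → ℝ}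
    {g : ι → ℕ → ℝ} {D ε : ι → ℝ} {d : ℝ} (hg : ∀ i, Tendsto (g i) atTop (𝓝 (D i))) (hD : Tendsto D l (𝓝 d))
    (hε : Tendsto ε l (𝓝 0)) (hfg : ∀ᶠ i in l, ∀ N, |f N - g i N| ≤ ε i) :
    Tendsto f atTop (𝓝 d) := by
  rw [Metric.tendsto_atTop']
  intro η hη
  obtain ⟨i, h1, h2, h3⟩ := ((hD.eventually (Metric.ball_mem_nhds d (by positivity : 0 < η / 3))).and
    ((hε.eventually (gt_mem_nhds (by positivity : 0 < η / 3))).and hfg)).exists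
  obtain ⟨M, hM⟩ := Metric.tendsto_atTop'.1 (hg i) (η / 3) (by positivity)
  refine ⟨M, fun N hN => ?_⟩
  have h4 := hM N hN
  have h5 := h3 N
  rw [Real.dist_eq] at h1 h4 ⊢
  rw [abs_lt] at *
  rw [abs_le] at h5
  constructor <;> linarith [h5.1, h5.2, h4.1, h4.2, h1.1, h1.2]

theorem summable_one_div_prime_sq : Summable fun p : {p : ℕ // p.Prime} => 1 / ((p : ℕ) : ℝ) ^ 2 :=
  (Real.summable_one_div_nat_pow.2 one_lt_two).subtype {p : ℕ | p.Prime}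

theorem countUpTo_exists_sq_dvd_le (P : Finset {p : ℕ // p.Prime}) (N : ℕ) :
    (countUpTo {n | ∃ p : {p : ℕ // p.Prime}, p ∉ P ∧ (p : ℕ) ^ 2 ∣ n} N : ℝ) ≤
      N * ∑' p : {p // p ∉ P}, 1 / ((p : ℕ) : ℝ) ^ 2 := by
  classical
  set T : Finset {p // p ∉ P} :=
    (Finset.subtype (· ∉ P) ((Finset.range (N + 1)).subtype Nat.Prime)) with hT
  have hsub : {n | 1 ≤ n ∧ n ≤ N ∧ n ∈ {n | ∃ p : {p : ℕ // p.Prime}, p ∉ P ∧ (p : ℕ) ^ 2 ∣ n}} ⊆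
      ⋃ p ∈ T, {n | 1 ≤ n ∧ n ≤ N ∧ n ∈ {n | n ∈ Set.univ ∧ (p : ℕ) ^ 2 ∣ n}} := by
    rintro n ⟨h1, h2, p, hp, hpn⟩
    simp only [Set.mem_iUnion]
    have : (p : ℕ) ≤ N := (Nat.le_self_pow two_ne_zero _).trans ((Nat.le_of_dvd h1 hpn).trans h2)
    exact ⟨⟨p, hp⟩, by simp [hT]; omega, h1, h2, trivial, hpn⟩
  have h1 : countUpTo {n | ∃ p : {p : ℕ // p.Prime}, p ∉ P ∧ (p : ℕ) ^ 2 ∣ n} N ≤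
      ∑ p ∈ T, N / (p : ℕ) ^ 2 := by
    refine (Set.ncard_le_ncard hsub
      (T.finite_toSet.biUnion fun p _ => finite_bounded_part _ N)).trans ?_
    refine (Finset.set_ncard_biUnion_le T _).trans (Finset.sum_le_sum fun p _ => ?_)
    refine (countUpTo_multiples (pow_pos p.1.2.pos 2) (by simp) N).trans_le (countUpTo_le _ _)
  calc _ ≤ ((∑ p ∈ T, N / (p : ℕ) ^ 2 : ℕ) : ℝ) := by exact_mod_cast h1
    _ ≤ ∑ p ∈ T, N * (1 / ((p : ℕ) : ℝ) ^ 2) := by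
      push_cast
      refine Finset.sum_le_sum fun p _ => ?_
      rw [mul_one_div]
      exact_mod_cast Nat.cast_div_le (α := ℝ) (m := N) (n := (p : ℕ) ^ 2)
    _ = N * ∑ p ∈ T, (1 / ((p : ℕ) : ℝ) ^ 2) := by rw [Finset.mul_sum]
    _ ≤ _ := by
      gcongr
      exact (summable_one_div_prime_sq.subtype {p | p ∉ P}).sum_le_tsum T (fun _ _ => by positivity)

theorem not_towerMem_zero (q : ℕ) : ¬ TowerMem q 0 := by
  rintro (⟨_, h, _⟩ | ⟨_, _, h, _⟩) <;> omega

theorem not_towerMem_one (q : ℕ) : ¬ TowerMem q 1 := by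
  rintro (⟨_, h, _⟩ | ⟨_, _, h, _⟩) <;> omega

theorem towerMem_iff {q n : ℕ} (hq : q.Prime) (hn : 1 ≤ n) :
    TowerMem q n ↔ q ∣ n ∨ ∃ p : {p : ℕ // p.Prime}, TowerMem q (n.factorization p) := by
  constructor
  · rintro (⟨_, h, h'⟩ | ⟨_, p, h, hp, hd, he⟩)
    · exact Or.inl h'
    · exact Or.inr ⟨⟨p, hp⟩, he⟩
  · rintro (h | ⟨p, h⟩)
    · exact .base n (hq.two_le.trans (Nat.le_of_dvd hn h)) h
    · have hd : (p : ℕ) ∣ n := by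
        by_contra hd
        rw [Nat.factorization_eq_zero_of_not_dvd hd] at h
        exact not_towerMem_zero q h
      exact .step n p (p.2.two_le.trans (Nat.le_of_dvd hn hd)) p.2 hd h

/-- The exponents of `p` allowed in an integer outside `M(q)`. -/
def allowedExponents (q p : ℕ) : Set ℕ :=
  {m | if p = q then m = 0 else ¬ TowerMem q m}

theorem zero_mem_allowedExponents (q p : ℕ) : 0 ∈ allowedExponents q p := by
  simp [allowedExponents, not_towerMem_zero]

theorem not_towerMem_iff {q n : ℕ} (hq : q.Prime) (hn : 1 ≤ n) :
    ¬ TowerMem q n ↔ ∀ p : {p : ℕ // p.Prime}, n.factorization p ∈ allowedExponents q p := by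
  rw [towerMem_iff hq hn, not_or, not_exists]
  have hz : n.factorization q = 0 ↔ ¬ q ∣ n := by
    rw [Nat.factorization_eq_zero_iff]
    simp [hq]; omega
  constructor
  · rintro ⟨h, h'⟩ p
    by_cases hp : (p : ℕ) = q
    · simp only [allowedExponents, Set.mem_ofPred_eq, if_pos hp]
      rwa [hp, hz]
    · simpa only [allowedExponents, Set.mem_ofPred_eq, if_neg hp] using h' p
  · intro h
    have hq0 : n.factorization q = 0 := by simpa [allowedExponents] using h ⟨q, hq⟩
    refine ⟨hz.1 hq0, fun p => ?_⟩
    by_cases hp : (p : ℕ) = q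
    · rw [hp, hq0]; exact not_towerMem_zero q
    · simpa only [allowedExponents, Set.mem_ofPred_eq, if_neg hp] using h p

theorem towerRatio_eq (q : ℕ) {N : ℕ} (hN : 0 < N) :
    towerRatio q N = 1 - (countUpTo {n | ¬ TowerMem q n} N : ℝ) / N := by
  classical
  have h0 : towerRatio q N = (countUpTo {n | TowerMem q n} N : ℝ) / N := by
    rw [towerRatio, countUpTo, ← Set.ncard_coe_finset]
    congr 3
    ext n
    simp [and_assoc]
  have h1 := countUpTo_union_of_disjoint
    (fun n _ (h : n ∈ {n | TowerMem q n}) (h' : n ∈ {n | ¬ TowerMem q n}) => h' h) N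
  have h2 : {n | TowerMem q n} ∪ {n | ¬ TowerMem q n} = Set.univ := by
    ext n; simp [em]
  rw [h2, countUpTo_univ] at h1
  have hN' : (N : ℝ) ≠ 0 := by exact_mod_cast hN.ne'
  have h3 : (N : ℝ) = countUpTo {n | TowerMem q n} N + countUpTo {n | ¬ TowerMem q n} N := by
    exact_mod_cast h1
  rw [h0, eq_sub_iff_add_eq, ← add_div, ← h3, div_self hN']

theorem abs_local_factor_sub_one_le {E : Set ℕ} (h0 : 0 ∈ E) (h1 : 1 ∈ E) {x : ℝ} (hx : 1 < x) :
    |(1 - 1 / x) * ∑' m : E, 1 / x ^ (m : ℕ) - 1| ≤ 1 / x ^ 2 := by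
  have hx0 : 0 < x := by linarith
  have hs : HasSum (fun m : ℕ => 1 / x ^ m) (1 - x⁻¹)⁻¹ := by
    simpa [one_div] using hasSum_geometric_of_lt_one (inv_nonneg.2 hx0.le) (inv_lt_one_of_one_lt₀ hx)
  have hy : 0 < 1 - 1 / x := by
    rw [one_div]; exact sub_pos.2 (inv_lt_one_of_one_lt₀ hx)
  have hle : ∑' m : E, 1 / x ^ (m : ℕ) ≤ (1 - 1 / x)⁻¹ := by
    rw [one_div x, ← hs.tsum_eq]
    exact hs.summable.tsum_subtype_le (fun m : ℕ => 1 / x ^ m) E (fun m => by positivity)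
  have hge : 1 + 1 / x ≤ ∑' m : E, 1 / x ^ (m : ℕ) := by
    have hsE : Summable fun m : E => 1 / x ^ (m : ℕ) := hs.summable.subtype E
    have := hsE.sum_le_tsum {⟨0, h0⟩, ⟨1, h1⟩} (fun _ _ => by positivity)
    rw [Finset.sum_pair (by simp)] at this
    simpa using this
  have ha := mul_le_mul_of_nonneg_left hle hy.le
  have hb := mul_le_mul_of_nonneg_left hge hy.le
  rw [mul_inv_cancel₀ hy.ne'] at ha
  rw [abs_le, ← one_div_pow]
  constructor <;> nlinarith [sq_nonneg (1 / x)]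

theorem tower_density_exists_eq_prod_all_primes (q : ℕ) (hq : q.Prime) :
    Tendsto (towerRatio q) atTop
      (𝓝 (1 - (∑' m : {m : ℕ // ¬ TowerMem q m}, 1 / (q : ℝ) ^ (m : ℕ))⁻¹ *
        ∏' p : {p : ℕ // p.Prime},
          ((1 - 1 / ((p : ℕ) : ℝ)) *
            ∑' m : {m : ℕ // ¬ TowerMem q m}, 1 / ((p : ℕ) : ℝ) ^ (m : ℕ)))) := by
  classical
  set S : ℕ → ℝ := fun p => ∑' m : {m : ℕ // ¬ TowerMem q m}, 1 / (p : ℝ) ^ (m : ℕ)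
  have hone : ∀ p : {p : ℕ // p.Prime}, (1 : ℝ) < (p : ℕ) := fun p => by exact_mod_cast p.2.one_lt
  have hmul : Multipliable fun p : {p : ℕ // p.Prime} => (1 - 1 / ((p : ℕ) : ℝ)) * S p := by
    have := multipliable_one_add_of_summable (f := fun p : {p : ℕ // p.Prime} =>
      (1 - 1 / ((p : ℕ) : ℝ)) * S p - 1)
      (summable_one_div_prime_sq.of_nonneg_of_le (fun _ => norm_nonneg _) fun p =>
        abs_local_factor_sub_one_le (E := {m | ¬ TowerMem q m}) (not_towerMem_zero q)
          (not_towerMem_one q) (hone p))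
    simpa using this
  have hSq : S q ≠ 0 := by
    intro h
    have := abs_local_factor_sub_one_le (E := {m | ¬ TowerMem q m}) (not_towerMem_zero q)
          (not_towerMem_one q) (hone ⟨q, hq⟩)
    change |(1 - 1 / (q : ℝ)) * S q - 1| ≤ 1 / (q : ℝ) ^ 2 at this
    have h2 := one_lt_pow₀ (hone ⟨q, hq⟩) two_ne_zero
    rw [h] at this
    simp only [mul_zero, zero_sub, abs_neg, abs_one] at this
    rw [le_div_iff₀ (by linarith)] at this
    change 1 < (q : ℝ) ^ 2 at h2
    linarith
  have hfac : ∀ p : {p : ℕ // p.Prime}, (p : ℕ) ≠ q →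
      ∑' m : allowedExponents q p, 1 / ((p : ℕ) : ℝ) ^ (m : ℕ) = S p := by
    intro p hp
    have : allowedExponents q p = {m | ¬ TowerMem q m} := by
      ext m; simp [allowedExponents, hp]
    rw [this]; rfl
  have hfacq : ∑' m : allowedExponents q q, 1 / (q : ℝ) ^ (m : ℕ) = 1 := by
    have : allowedExponents q q = {0} := by
      ext m; simp [allowedExponents]
    rw [this, tsum_singleton (0 : ℕ) fun m => 1 / (q : ℝ) ^ m]
    simp
  have hev : ∀ᶠ P : Finset {p : ℕ // p.Prime} in atTop, ⟨q, hq⟩ ∈ P := by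
    filter_upwards [eventually_ge_atTop {⟨q, hq⟩}] with P hP using hP (Finset.mem_singleton_self _)
  have hlim : Tendsto (fun N : ℕ => (countUpTo {n | ¬ TowerMem q n} N : ℝ) / N) atTop
      (𝓝 ((S q)⁻¹ * ∏' p : {p : ℕ // p.Prime}, ((1 - 1 / ((p : ℕ) : ℝ)) * S p))) := by
    refine tendsto_of_uniform_approx (l := atTop)
      (fun P => hasNatDensity_forall_factorization_mem (allowedExponents q) P) ?_
      (tendsto_tsum_compl_atTop_zero fun p : {p : ℕ // p.Prime} => 1 / ((p : ℕ) : ℝ) ^ 2) ?_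
    · refine (hmul.hasProd.const_mul (S q)⁻¹).congr' ?_
      filter_upwards [hev] with P hP
      rw [← Finset.mul_prod_erase _ _ hP, ← Finset.mul_prod_erase P (fun p : {p : ℕ // p.Prime} =>
        (1 - 1 / ((p : ℕ) : ℝ)) * ∑' m : allowedExponents q p, 1 / ((p : ℕ) : ℝ) ^ (m : ℕ)) hP]
      simp only [hfacq]
      rw [Finset.prod_congr rfl fun (p : {p : ℕ // p.Prime}) hp =>
        congrArg (fun t => (1 - 1 / ((p : ℕ) : ℝ)) * t)
        (hfac p fun h => (Finset.mem_erase.1 hp).1 (Subtype.ext h))]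
      field_simp
    · filter_upwards [hev] with P hP N
      rcases Nat.eq_zero_or_pos N with rfl | hN
      · simp only [Nat.cast_zero, div_zero, sub_zero, abs_zero]
        exact tsum_nonneg fun _ => by positivity
      have hN' : (0 : ℝ) < N := by exact_mod_cast hN
      set A := {n : ℕ | ∀ p ∈ P, n.factorization p ∈ allowedExponents q p}
      set B := {n | ∃ p : {p : ℕ // p.Prime}, p ∉ P ∧ (p : ℕ) ^ 2 ∣ n}
      have h1 : countUpTo {n | ¬ TowerMem q n} N ≤ countUpTo A N := by
        refine Set.ncard_le_ncard ?_ (finite_bounded_part _ N)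
        rintro n ⟨h1, h2, h3⟩
        exact ⟨h1, h2, fun p _ => (not_towerMem_iff hq h1).1 h3 p⟩
      have h2 : countUpTo A N ≤ countUpTo {n | ¬ TowerMem q n} N + countUpTo B N := by
        refine le_trans ?_ (countUpTo_union_le _ _ N)
        refine Set.ncard_le_ncard ?_ (finite_bounded_part _ N)
        rintro n ⟨h1, h2, h3⟩
        refine ⟨h1, h2, or_iff_not_imp_right.2 fun hB => (not_towerMem_iff hq h1).2 fun p => ?_⟩
        by_cases hp : p ∈ P
        · exact h3 p hp
        · have hpq : (p : ℕ) ≠ q := fun h => hp (by convert hP)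
          have hlt : n.factorization p < 2 := by
            by_contra! hge
            exact hB ⟨p, hp, (p.2.pow_dvd_iff_le_factorization (by omega)).2 hge⟩
          simp only [allowedExponents, Set.mem_ofPred_eq, if_neg hpq]
          interval_cases n.factorization p
          · exact not_towerMem_zero q
          · exact not_towerMem_one q
      have h3 := countUpTo_exists_sq_dvd_le P N
      have h1' : (countUpTo {n | ¬ TowerMem q n} N : ℝ) ≤ countUpTo A N := by exact_mod_cast h1
      have h2' : (countUpTo A N : ℝ) ≤ countUpTo {n | ¬ TowerMem q n} N + countUpTo B N := by
        exact_mod_cast h2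
      rw [← sub_div, abs_div, abs_of_pos hN', div_le_iff₀ hN', abs_le]
      constructor <;> linarith
  refine (hlim.const_sub 1).congr' ?_
  filter_upwards [eventually_gt_atTop 0] with N hN using (towerRatio_eq q hN).symm
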